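/- Let P = ⟨H,M,T⟩ be an abduction problem and let r, s, t be three fresh propositional variables not occurring in H, M, or T. Define P' = ⟨H',M',T'⟩ by H' = H ∪ {r,s}, M' = M ∪ {t}, and T' = T ∪ { s → m : m ∈ M ∪ {t} } ∪ { r → t } ∪ { ¬s ∨ ¬h : h ∈ H }. If H'' ∈ SOL(P') and s ∉ H'', then r ∈ H'' and H'' \ {r} ∈ SOL(P). -/

import Mathlib

/-- Propositional formulas over a set `V` of variables. -/
inductive PropForm (V : Type) : Type where
  | fls  : PropForm V
  | var  : V → PropForm V
  | neg  : PropForm V → PropForm V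
  | conj : PropForm V → PropForm V → PropForm V
  | disj : PropForm V → PropForm V → PropForm V
  | imp  : PropForm V → PropForm V → PropForm V
  deriving DecidableEq

namespace PropForm

/-- Truth of a formula under a valuation. -/
def eval {V : Type} (v : V → Prop) : PropForm V → Prop
  | fls => False
  | var x => v x
  | neg φ => ¬ eval v φ
  | conj φ ψ => eval v φ ∧ eval v ψ
  | disj φ ψ => eval v φ ∨ eval v ψ
  | imp φ ψ => eval v φ → eval v ψ

/-- The set of variables occurring in a formula. -/
def vars {V : Type} : PropForm V → Set V
  | fls => ∅
  | var x => {x}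
  | neg φ => vars φ
  | conj φ ψ => vars φ ∪ vars ψ
  | disj φ ψ => vars φ ∪ vars ψ
  | imp φ ψ => vars φ ∪ vars ψ

end PropForm

/-- An abduction problem `⟨H, M, T⟩`: hypotheses, manifestations, theory. -/
structure AbdProblem (V : Type) [DecidableEq V] : Type where
  H : Finset V
  M : Finset V
  T : Finset (PropForm V)

variable {V : Type} [DecidableEq V]

/-- `v` is a model of the hypotheses `A` together with the theory `T`. -/
def models (v : V → Prop) (A : Finset V) (T : Finset (PropForm V)) : Prop :=
  (∀ x ∈ A, v x) ∧ (∀ φ ∈ T, φ.eval v)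

/-- `A` is a solution of `P`: `A ⊆ H`, `A ∪ T` is satisfiable, `A ∪ T ⊨ m` for `m ∈ M`. -/
def isSol (P : AbdProblem V) (A : Finset V) : Prop :=
  A ⊆ P.H ∧ (∃ v, models v A P.T) ∧ ∀ v, models v A P.T → ∀ m ∈ P.M, v m

/-- The set of solutions of `P`. -/
def SOL (P : AbdProblem V) : Set (Finset V) := {A | isSol P A}

/-- The solutions of `P` minimal under set inclusion. -/
def SOLsub (P : AbdProblem V) : Set (Finset V) :=
  {A | A ∈ SOL P ∧ ∀ B ∈ SOL P, B ⊆ A → B = A}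

/-- The solutions of `P` of minimum cardinality. -/
def SOLcard (P : AbdProblem V) : Set (Finset V) :=
  {A | A ∈ SOL P ∧ ∀ B ∈ SOL P, A.card ≤ B.card}

/-- `x` is fresh for `P`: it occurs neither in `H`, nor in `M`, nor in any formula of `T`. -/
def freshFor (P : AbdProblem V) (x : V) : Prop :=
  x ∉ P.H ∧ x ∉ P.M ∧ ∀ φ ∈ P.T, x ∉ φ.vars

/-- The problem `P' = ⟨H ∪ {r,s}, M ∪ {t},
    T ∪ {s → m : m ∈ M ∪ {t}} ∪ {r → t} ∪ {¬s ∨ ¬h : h ∈ H}⟩`. -/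
def addSol (P : AbdProblem V) (r s t : V) : AbdProblem V where
  H := P.H ∪ {r, s}
  M := P.M ∪ {t}
  T := P.T
    ∪ (P.M ∪ {t}).image (fun m => PropForm.imp (PropForm.var s) (PropForm.var m))
    ∪ {PropForm.imp (PropForm.var r) (PropForm.var t)}
    ∪ P.H.image (fun h => PropForm.disj (PropForm.neg (PropForm.var s)) (PropForm.neg (PropForm.var h)))

theorem PropForm.eval_congr {W : Type} {v w : W → Prop} (φ : PropForm W) (h : ∀ x ∈ φ.vars, v x ↔ w x) :
    φ.eval v ↔ φ.eval w := by
  induction φ with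
  | fls => rfl
  | var x => exact h x rfl
  | neg φ ih => exact not_congr (ih h)
  | conj φ ψ ihφ ihψ =>
    exact and_congr (ihφ fun x hx => h x (.inl hx)) (ihψ fun x hx => h x (.inr hx))
  | disj φ ψ ihφ ihψ =>
    exact or_congr (ihφ fun x hx => h x (.inl hx)) (ihψ fun x hx => h x (.inr hx))
  | imp φ ψ ihφ ihψ =>
    exact imp_congr (ihφ fun x hx => h x (.inl hx)) (ihψ fun x hx => h x (.inr hx))

theorem eval_of_mem_addSol {P : AbdProblem V} {r s t : V} {v w : V → Prop}
    (hT : ∀ φ ∈ P.T, φ.eval v) (hvw : ∀ φ ∈ P.T, ∀ x ∈ φ.vars, v x ↔ w x)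
    (hs : ¬ w s) (hrt : w r → w t) : ∀ φ ∈ (addSol P r s t).T, φ.eval w := by
  intro φ hφ
  simp only [addSol, Finset.mem_union, Finset.mem_image, Finset.mem_singleton] at hφ
  rcases hφ with ((hφ | ⟨m, -, rfl⟩) | rfl) | ⟨h, -, rfl⟩
  · exact (φ.eval_congr (hvw φ hφ)).mp (hT φ hφ)
  · exact fun h => absurd h hs
  · exact hrt
  · exact .inl hs

/-- The valuation sending `s` to false, `r` and `t` to `b`, and agreeing with `v` elsewhere. -/
def override (v : V → Prop) (r s t : V) (b : Prop) (x : V) : Prop :=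
  x ≠ s ∧ ((x = r ∨ x = t) ∧ b ∨ x ≠ r ∧ x ≠ t ∧ v x)

theorem override_iff {W : Type} {v : W → Prop} {r s t x : W} {b : Prop}
    (hr : x ≠ r) (hs : x ≠ s) (ht : x ≠ t) : v x ↔ override v r s t b x := by
  simp [override, hr, hs, ht]

theorem eval_override {P : AbdProblem V} {r s t : V} (hfr : freshFor P r) (hfs : freshFor P s)
    (hft : freshFor P t) (hst : s ≠ t) {v : V → Prop} (b : Prop)
    (hT : ∀ φ ∈ P.T, φ.eval v) : ∀ φ ∈ (addSol P r s t).T, φ.eval (override v r s t b) := by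
  refine eval_of_mem_addSol hT (fun φ hφ x hx => override_iff ?_ ?_ ?_) (by simp [override]) ?_
  · rintro rfl; exact hfr.2.2 φ hφ hx
  · rintro rfl; exact hfs.2.2 φ hφ hx
  · rintro rfl; exact hft.2.2 φ hφ hx
  · simp [override, hst.symm]

theorem solution_without_s (P : AbdProblem V) (r s t : V)
    (hfr : freshFor P r) (hfs : freshFor P s) (hft : freshFor P t)
    (hrs : r ≠ s) (hrt : r ≠ t) (hst : s ≠ t)
    (H'' : Finset V) (hH'' : H'' ∈ SOL (addSol P r s t)) (hsH : s ∉ H'') :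
    r ∈ H'' ∧ H'' \ {r} ∈ SOL P := by
  obtain ⟨hsub, ⟨v₀, hv₀H, hv₀T⟩, hent⟩ := hH''
  have hT : ∀ φ ∈ P.T, φ.eval v₀ := fun φ hφ => hv₀T φ (by simp [addSol, hφ])
  have mem_H : ∀ x ∈ H'', x ≠ r → x ∈ P.H := by
    intro x hx hxr
    have hxs : x ≠ s := ne_of_mem_of_not_mem hx hsH
    simpa [addSol, hxr, hxs] using hsub hx
  have override_H : ∀ (v : V → Prop) (b : Prop), ∀ x ∈ P.H, v x ↔ override v r s t b x :=
    fun v b x hx => override_iff (ne_of_mem_of_not_mem hx hfr.1)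
      (ne_of_mem_of_not_mem hx hfs.1) (ne_of_mem_of_not_mem hx hft.1)
  refine ⟨?_, ?_, ⟨v₀, fun x hx => hv₀H x (Finset.mem_sdiff.mp hx).1, hT⟩, ?_⟩
  · by_contra hr
    have ht := hent (override v₀ r s t False)
      ⟨fun x hx => (override_H v₀ False x (mem_H x hx (ne_of_mem_of_not_mem hx hr))).mp
        (hv₀H x hx), eval_override hfr hfs hft hst False hT⟩ t (by simp [addSol])
    simp [override] at ht
  · intro x hx
    simp only [Finset.mem_sdiff, Finset.mem_singleton] at hx
    exact mem_H x hx.1 hx.2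
  · rintro v ⟨hvH, hvT⟩ m hm
    refine (override_iff (b := True) (ne_of_mem_of_not_mem hm hfr.2.1)
      (ne_of_mem_of_not_mem hm hfs.2.1) (ne_of_mem_of_not_mem hm hft.2.1)).mpr
      (hent _ ⟨fun x hx => ?_, eval_override hfr hfs hft hst True hvT⟩ m (by simp [addSol, hm]))
    by_cases hxr : x = r
    · simp [override, hxr, hrs]
    · exact (override_H v True x (mem_H x hx hxr)).mp (hvH x (by simp [hx, hxr]))
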